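/- arXiv:1807.04974 — 3 statements merged into one kernel-verified Lean document; each statement's English description precedes it below -/
import Mathlib

section
/- There is an absolute constant C > 0 such that for every weighted undirected hypergraph G = (V, E, w) on a finite vertex set V with n = |V| ≥ 2 vertices and every ε ∈ (0,1), there exists a weighted subhypergraph H of G with at most C · n³ · (log n) / ε² hyperedges that is an ε-spectral sparsifier of G. -/
open Finset

/-- The Laplacian quadratic form of a weighted undirected hypergraph with hyperedge
set `E` and weights `w`:  `Q(x) = Σ_{e ∈ E} w(e) · max_{u,v ∈ e} (x(u) - x(v))²`. -/
noncomputable def hyperQuadForm {V : Type} [DecidableEq V]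
    (E : Finset (Finset V)) (w : Finset V → ℝ) (x : V → ℝ) : ℝ :=
  ∑ e ∈ E, w e *
    (if h : e.Nonempty then e.sup' h (fun u => e.sup' h fun v => (x u - x v) ^ 2) else 0)

/-- Greedy derandomisation: if each `exp ∘ f k` has `q`-average at most `ρ`, then one can draw `m`
samples (recorded by multiplicity) keeping the sum of exponential potentials below its mean. -/
theorem exists_multiplicity_sum_exp_le {α K : Type*} [DecidableEq α] [Fintype K] (A : Finset α)
    (q : α → ℝ) (hq : ∀ a ∈ A, 0 ≤ q a) (hq1 : ∑ a ∈ A, q a = 1) (f : K → α → ℝ) (ρ : ℝ)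
    (hf : ∀ k, ∑ a ∈ A, q a * Real.exp (f k a) ≤ ρ) (m : ℕ) :
    ∃ h : α → ℕ, ∑ a ∈ A, h a = m ∧
      ∑ k, Real.exp (∑ a ∈ A, h a * f k a) ≤ Fintype.card K * ρ ^ m := by
  have hρ : 0 ≤ ρ ∨ IsEmpty K := by
    by_cases hK : IsEmpty K
    · exact Or.inr hK
    · obtain ⟨k⟩ := not_isEmpty_iff.1 hK
      exact Or.inl ((sum_nonneg fun a ha => mul_nonneg (hq a ha) (Real.exp_pos _).le).trans (hf k))
  rcases hρ with hρ | hK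
  swap
  · have hA : A.Nonempty := by
      rw [nonempty_iff_ne_empty]
      rintro rfl
      simp at hq1
    obtain ⟨a, ha⟩ := hA
    exact ⟨Pi.single a m, by simp [Pi.single_apply, ha], by simp⟩
  induction m with
  | zero => exact ⟨0, by simp, by simp⟩
  | succ m ih =>
    obtain ⟨h, hm, hh⟩ := ih
    set c : K → ℝ := fun k => Real.exp (∑ a ∈ A, h a * f k a) with hc
    have hstep : ∑ a ∈ A, q a * ∑ k, c k * Real.exp (f k a) ≤ ∑ a ∈ A, q a * (ρ * ∑ k, c k) := by
      rw [← sum_mul, hq1, one_mul, mul_sum]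
      calc ∑ a ∈ A, q a * ∑ k, c k * Real.exp (f k a)
          = ∑ k, c k * ∑ a ∈ A, q a * Real.exp (f k a) := by
            simp only [mul_sum]
            rw [sum_comm]
            exact sum_congr rfl fun k _ => sum_congr rfl fun a _ => by ring
        _ ≤ ∑ k, ρ * c k := sum_le_sum fun k _ => by
            rw [mul_comm ρ]
            exact mul_le_mul_of_nonneg_left (hf k) (Real.exp_pos _).le
    have hpos : ∃ a ∈ A, 0 < q a ∧
        q a * ∑ k, c k * Real.exp (f k a) ≤ q a * (ρ * ∑ k, c k) := by
      by_contra! hcon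
      have hall : ∀ a ∈ A, q a * (ρ * ∑ k, c k) ≤ q a * ∑ k, c k * Real.exp (f k a) := by
        intro a ha
        rcases (hq a ha).eq_or_lt with h0 | h0
        · simp [← h0]
        · exact (hcon a ha h0).le
      obtain ⟨a, ha, hqa⟩ : ∃ a ∈ A, 0 < q a := by
        by_contra! h0
        linarith [sum_nonpos h0]
      exact absurd hstep (not_le.2 (sum_lt_sum hall ⟨a, ha, hcon a ha hqa⟩))
    obtain ⟨a, ha, hqa, hle⟩ := hpos
    have hle' := le_of_mul_le_mul_left hle hqa
    refine ⟨h + Pi.single a 1, ?_, ?_⟩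
    · simp [sum_add_distrib, hm, Pi.single_apply, ha]
    · have hk : ∀ k, Real.exp (∑ b ∈ A, ((h + Pi.single a 1 : α → ℕ) b : ℝ) * f k b)
          = c k * Real.exp (f k a) := by
        intro k
        rw [hc, ← Real.exp_add]
        congr 1
        simp [add_mul, sum_add_distrib, Pi.single_apply, ha]
      simp only [hk]
      calc ∑ k, c k * Real.exp (f k a) ≤ ρ * ∑ k, c k := hle'
        _ ≤ ρ * (Fintype.card K * ρ ^ m) := mul_le_mul_of_nonneg_left hh hρ
        _ = _ := by ring

/-- Bernstein-type bound for the moment generating function of a variable in `[0, S]` with mean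
`μ ≤ 1`. -/
theorem sum_mul_exp_sub_mean_le {α : Type*} (A : Finset α) (q y : α → ℝ) {S t : ℝ}
    (hq : ∀ a ∈ A, 0 ≤ q a) (hq1 : ∑ a ∈ A, q a = 1) (hy0 : ∀ a ∈ A, 0 ≤ y a)
    (hyS : ∀ a ∈ A, y a ≤ S) (hμ : ∑ a ∈ A, q a * y a ≤ 1) (hS : 0 ≤ S) (ht : |t| * S ≤ 1) :
    ∑ a ∈ A, q a * Real.exp (t * (y a - ∑ b ∈ A, q b * y b)) ≤ Real.exp (t ^ 2 * S) := by
  set μ := ∑ b ∈ A, q b * y b with hμdef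
  have hexp : ∀ a ∈ A, Real.exp (t * y a) ≤ 1 + t * y a + t ^ 2 * (S * y a) := by
    intro a ha
    have h1 : |t * y a| ≤ 1 := by
      rw [abs_mul, abs_of_nonneg (hy0 a ha)]
      exact (mul_le_mul_of_nonneg_left (hyS a ha) (abs_nonneg t)).trans ht
    have h2 := (abs_le.1 (Real.abs_exp_sub_one_sub_id_le h1)).2
    have h3 : t ^ 2 * (y a * y a) ≤ t ^ 2 * (S * y a) := by
      gcongr
      · exact hy0 a ha
      · exact hyS a ha
    nlinarith
  have hsum : ∑ a ∈ A, q a * Real.exp (t * y a) ≤ 1 + t * μ + t ^ 2 * S := by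
    calc ∑ a ∈ A, q a * Real.exp (t * y a)
        ≤ ∑ a ∈ A, q a * (1 + t * y a + t ^ 2 * (S * y a)) :=
          sum_le_sum fun a ha => mul_le_mul_of_nonneg_left (hexp a ha) (hq a ha)
      _ = ∑ a ∈ A, q a + t * μ + t ^ 2 * (S * μ) := by
          rw [hμdef]
          simp only [mul_sum, ← sum_add_distrib]
          exact sum_congr rfl fun a _ => by ring
      _ ≤ 1 + t * μ + t ^ 2 * S := by
          rw [hq1]
          have : t ^ 2 * (S * μ) ≤ t ^ 2 * (S * 1) := by gcongr
          linarith
  calc ∑ a ∈ A, q a * Real.exp (t * (y a - μ))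
      = (∑ a ∈ A, q a * Real.exp (t * y a)) * Real.exp (-(t * μ)) := by
        rw [sum_mul]
        refine sum_congr rfl fun a _ => ?_
        rw [mul_assoc, ← Real.exp_add]
        ring_nf
    _ ≤ Real.exp (t * μ + t ^ 2 * S) * Real.exp (-(t * μ)) := by
        gcongr
        refine hsum.trans ?_
        have := Real.add_one_le_exp (t * μ + t ^ 2 * S)
        linarith
    _ = Real.exp (t ^ 2 * S) := by
        rw [← Real.exp_add]
        ring_nf

/-- Importance sampling: finitely many test functions dominated by `r`, each of `w`-mass at most
one, are simultaneously approximated by a reweighting supported on few points. -/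
theorem exists_sparse_reweighting {α J : Type*} [DecidableEq α] [Fintype J] [Nonempty J]
    (A : Finset α) (w r : α → ℝ) (hw : ∀ a ∈ A, 0 < w a) (hr : ∀ a ∈ A, 0 < r a)
    (g : J → α → ℝ) (hg0 : ∀ j, ∀ a ∈ A, 0 ≤ g j a) (hgr : ∀ j, ∀ a ∈ A, g j a ≤ r a)
    (hg1 : ∀ j, ∑ a ∈ A, w a * g j a ≤ 1) {S δ : ℝ} (hS : ∑ a ∈ A, w a * r a ≤ S)
    (hδ : 0 < δ) (hδ1 : δ ≤ 1) (m : ℕ)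
    (hm : 4 * S * Real.log (2 * Fintype.card J) / δ ^ 2 ≤ m) :
    ∃ (A' : Finset α) (c : α → ℝ), A' ⊆ A ∧ (∀ a ∈ A', 0 ≤ c a) ∧ A'.card ≤ m ∧
      ∀ j, |∑ a ∈ A', c a * g j a - ∑ a ∈ A, w a * g j a| ≤ δ := by
  rcases A.eq_empty_or_nonempty with rfl | hA
  · exact ⟨∅, 0, by simp, by simp, by simp, fun j => by simpa using hδ.le⟩
  set S₀ := ∑ a ∈ A, w a * r a with hS₀
  have hS₀pos : 0 < S₀ := sum_pos (fun a ha => mul_pos (hw a ha) (hr a ha)) hA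
  set L := Real.log (2 * Fintype.card J) with hL
  have hJ : (1 : ℝ) ≤ Fintype.card J := by exact_mod_cast Fintype.card_pos (α := J)
  have hLpos : 0 < L := Real.log_pos (by linarith)
  have hm' : 4 * S₀ * L ≤ m * δ ^ 2 := by
    rw [div_le_iff₀ (by positivity)] at hm
    exact le_trans (by gcongr) hm
  have hmpos : (0 : ℝ) < m := by
    have : 0 < 4 * S₀ * L := by positivity
    by_contra! h0
    nlinarith [sq_nonneg δ]
  set t := δ / (2 * S₀) with ht
  have htpos : 0 < t := by positivity
  set q : α → ℝ := fun a => w a * r a / S₀ with hq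
  set y : J → α → ℝ := fun j a => S₀ * g j a / r a with hy
  have hq0 : ∀ a ∈ A, 0 ≤ q a := fun a ha =>
    div_nonneg (mul_pos (hw a ha) (hr a ha)).le hS₀pos.le
  have hq1 : ∑ a ∈ A, q a = 1 := by
    rw [hq, ← sum_div, ← hS₀, div_self hS₀pos.ne']
  have hqy : ∀ j, ∑ a ∈ A, q a * y j a = ∑ a ∈ A, w a * g j a := fun j =>
    sum_congr rfl fun a ha => by
      have := (hr a ha).ne'
      simp only [hq, hy]
      field_simp
  let sgn : Bool → ℝ := fun b => if b then 1 else -1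
  have hsgn : ∀ b, |sgn b| = 1 := by intro b; cases b <;> simp [sgn]
  have hsgn2 : ∀ b, sgn b ^ 2 = 1 := by intro b; cases b <;> simp [sgn]
  obtain ⟨h, hhm, hh⟩ := exists_multiplicity_sum_exp_le A q hq0 hq1
    (fun (k : J × Bool) a => sgn k.2 * t * (y k.1 a - ∑ b ∈ A, q b * y k.1 b))
    (Real.exp (t ^ 2 * S₀)) (by
      intro k
      have := sum_mul_exp_sub_mean_le A q (y k.1) (S := S₀) (t := sgn k.2 * t) hq0 hq1
        (fun a ha => div_nonneg (mul_nonneg hS₀pos.le (hg0 _ a ha)) (hr a ha).le)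
        (fun a ha => by
          rw [hy, div_le_iff₀ (hr a ha)]
          exact mul_le_mul_of_nonneg_left (hgr _ a ha) hS₀pos.le)
        (by rw [hqy]; exact hg1 _) hS₀pos.le
        (by
          rw [abs_mul, hsgn, one_mul, abs_of_pos htpos, ht]
          field_simp
          linarith)
      rwa [mul_pow, hsgn2, one_mul] at this) m
  have key : ∀ j b, sgn b * (∑ a ∈ A, h a * y j a - m * ∑ a ∈ A, w a * g j a) ≤ m * δ := by
    intro j b
    have h1 : Real.exp (∑ a ∈ A, h a * (sgn b * t * (y j a - ∑ b ∈ A, q b * y j b))) ≤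
        2 * Fintype.card J * Real.exp (t ^ 2 * S₀) ^ m := by
      refine (single_le_sum (f := fun k : J × Bool => Real.exp (∑ a ∈ A, h a *
        (sgn k.2 * t * (y k.1 a - ∑ b ∈ A, q b * y k.1 b)))) (fun k _ => (Real.exp_pos _).le)
        (mem_univ (j, b))).trans (hh.trans_eq ?_)
      simp only [Fintype.card_prod, Fintype.card_bool]
      push_cast
      ring
    have h2 : (2 : ℝ) * Fintype.card J * Real.exp (t ^ 2 * S₀) ^ m =
        Real.exp (L + m * (t ^ 2 * S₀)) := by
      rw [Real.exp_add, hL, Real.exp_log (by linarith), ← Real.exp_nat_mul]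
    rw [h2, Real.exp_le_exp] at h1
    have h3 : ∑ a ∈ A, h a * (sgn b * t * (y j a - ∑ b ∈ A, q b * y j b)) =
        t * (sgn b * (∑ a ∈ A, h a * y j a - m * ∑ a ∈ A, w a * g j a)) := by
      rw [hqy, ← hhm]
      push_cast
      rw [sum_mul, ← sum_sub_distrib, mul_sum, mul_sum]
      exact sum_congr rfl fun a _ => by ring
    rw [h3] at h1
    refine le_of_mul_le_mul_left (h1.trans ?_) htpos
    rw [ht]
    field_simp
    nlinarith
  refine ⟨A.filter fun a => h a ≠ 0, fun a => h a * S₀ / (m * r a), filter_subset _ _, ?_, ?_, ?_⟩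
  · intro a ha
    have := hr a (mem_filter.1 ha).1
    positivity
  · rw [← hhm, card_eq_sum_ones]
    calc ∑ a ∈ A with h a ≠ 0, 1 ≤ ∑ a ∈ A with h a ≠ 0, h a :=
          sum_le_sum fun a ha => Nat.one_le_iff_ne_zero.2 (mem_filter.1 ha).2
      _ ≤ ∑ a ∈ A, h a := sum_le_sum_of_subset (filter_subset _ _)
  · intro j
    have h1 : ∑ a ∈ A with h a ≠ 0, h a * S₀ / (m * r a) * g j a =
        (∑ a ∈ A, h a * y j a) / m := by
      rw [sum_filter, sum_div]
      refine sum_congr rfl fun a ha => ?_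
      have := (hr a ha).ne'
      split_ifs with h0
      · simp only [hy]
        field_simp
      · simp [not_not.1 h0]
    have h2 := key j true
    have h3 := key j false
    simp only [sgn, if_true, Bool.false_eq_true, if_false] at h2 h3
    rw [h1, abs_le]
    constructor
    · rw [neg_le_sub_iff_le_add, ← sub_le_iff_le_add, le_div_iff₀ hmpos]
      linarith
    · rw [sub_le_iff_le_add, div_le_iff₀ hmpos]
      linarith

/-- A `1/8`-separated subset of the unit ball of a finite-dimensional normed space has at most
`17 ^ d` elements. -/
theorem card_le_of_separated_unitBall {E : Type*} [NormedAddCommGroup E] [NormedSpace ℝ E]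
    [FiniteDimensional ℝ E] (s : Finset E) (hs : ∀ c ∈ s, ‖c‖ ≤ 1)
    (h : ∀ c ∈ s, ∀ d ∈ s, c ≠ d → 1 / 8 ≤ ‖c - d‖) :
    s.card ≤ 17 ^ Module.finrank ℝ E := by
  borelize E
  let μ : MeasureTheory.Measure E := MeasureTheory.Measure.addHaar
  have hdisj : Set.Pairwise (s : Set E)
      (Function.onFun Disjoint fun c => Metric.ball (c : E) (1 / 16)) := by
    rintro c hc d hd hcd
    apply Metric.ball_disjoint_ball
    rw [dist_eq_norm]
    linarith [h c hc d hd hcd]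
  have hsub : (⋃ c ∈ s, Metric.ball (c : E) (1 / 16)) ⊆ Metric.ball (0 : E) (17 / 16) := by
    refine Set.iUnion₂_subset fun x hx => Metric.ball_subset_ball' ?_
    rw [dist_zero_right]
    linarith [hs x hx]
  have hvol : (s.card : ENNReal) * ENNReal.ofReal ((1 / 16) ^ Module.finrank ℝ E) *
        μ (Metric.ball 0 1) ≤
      ENNReal.ofReal ((17 / 16) ^ Module.finrank ℝ E) * μ (Metric.ball 0 1) :=
    calc
      _ = μ (⋃ c ∈ s, Metric.ball (c : E) (1 / 16)) := by
        rw [MeasureTheory.measure_biUnion_finset hdisj fun c _ => measurableSet_ball]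
        simp only [μ.addHaar_ball_of_pos _ (by norm_num : (0 : ℝ) < 1 / 16), sum_const,
          nsmul_eq_mul, mul_assoc]
      _ ≤ μ (Metric.ball (0 : E) (17 / 16)) := MeasureTheory.measure_mono hsub
      _ = _ := μ.addHaar_ball_of_pos _ (by norm_num)
  have hcard := (ENNReal.mul_le_mul_iff_left (Metric.measure_ball_pos _ _ zero_lt_one).ne'
    MeasureTheory.measure_ball_lt_top.ne).1 hvol
  have hreal : (s.card : ℝ) ≤ (17 : ℝ) ^ Module.finrank ℝ E := by
    have := ENNReal.toReal_le_of_le_ofReal (by positivity) hcard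
    simpa [div_eq_mul_inv, mul_pow] using this
  exact mod_cast hreal

/-- The unit ball of a `d`-dimensional normed space has a `1/8`-net with at most `17 ^ d`
elements. -/
theorem exists_net_unitBall (E : Type*) [NormedAddCommGroup E] [NormedSpace ℝ E]
    [FiniteDimensional ℝ E] :
    ∃ s : Finset E, s.card ≤ 17 ^ Module.finrank ℝ E ∧ (∀ z ∈ s, ‖z‖ ≤ 1) ∧
      ∀ x, ‖x‖ ≤ 1 → ∃ z ∈ s, ‖x - z‖ ≤ 1 / 8 := by
  classical
  let P : ℕ → Prop := fun k => ∃ s : Finset E, s.card = k ∧ (∀ c ∈ s, ‖c‖ ≤ 1) ∧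
    ∀ c ∈ s, ∀ d ∈ s, c ≠ d → 1 / 8 ≤ ‖c - d‖
  have hP0 : P 0 := ⟨∅, by simp⟩
  obtain ⟨s, hcard, hs, hsep⟩ :=
    Nat.findGreatest_spec (Nat.zero_le (17 ^ Module.finrank ℝ E)) hP0
  refine ⟨s, hcard.le.trans (Nat.findGreatest_le _), hs, fun x hx => ?_⟩
  by_contra! hfar
  have hxs : x ∉ s := fun hxs => by
    have := hfar x hxs
    norm_num at this
  have hins : ∀ c ∈ insert x s, ∀ d ∈ insert x s, c ≠ d → 1 / 8 ≤ ‖c - d‖ := by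
    intro c hc d hd hcd
    rw [mem_insert] at hc hd
    rcases hc with rfl | hc
    · rcases hd with rfl | hd
      · exact absurd rfl hcd
      · exact (hfar d hd).le
    · rcases hd with rfl | hd
      · rw [norm_sub_rev]
        exact (hfar c hc).le
      · exact hsep c hc d hd hcd
  have hball : ∀ c ∈ insert x s, ‖c‖ ≤ 1 := by
    intro c hc
    rcases mem_insert.1 hc with rfl | hc
    · exact hx
    · exact hs c hc
  have hle := Nat.le_findGreatest (P := P) (card_le_of_separated_unitBall _ hball hins)
    ⟨_, rfl, hball, hins⟩
  rw [card_insert_of_notMem hxs, hcard] at hle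
  omega

/-- A net for the unit ball of the seminorm `x ↦ ‖T x‖`. -/
theorem exists_net_comap {E F : Type*} [AddCommGroup E] [Module ℝ E] [FiniteDimensional ℝ E]
    [NormedAddCommGroup F] [NormedSpace ℝ F] (T : E →ₗ[ℝ] F) :
    ∃ s : Finset E, s.card ≤ 17 ^ Module.finrank ℝ E ∧ (∀ z ∈ s, ‖T z‖ ≤ 1) ∧
      ∀ x, ‖T x‖ ≤ 1 → ∃ z ∈ s, ‖T (x - z)‖ ≤ 1 / 8 := by
  classical
  obtain ⟨s, hcard, hs, hnet⟩ := exists_net_unitBall (LinearMap.range T)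
  choose φ hφ using fun y : LinearMap.range T => y.2
  refine ⟨s.image φ, card_image_le.trans (hcard.trans
    (Nat.pow_le_pow_right (by norm_num) (LinearMap.finrank_range_le T))), ?_, ?_⟩
  · intro z hz
    obtain ⟨y, hy, rfl⟩ := mem_image.1 hz
    rw [hφ]
    exact hs y hy
  · intro x hx
    obtain ⟨y, hy, hxy⟩ := hnet ⟨T x, LinearMap.mem_range_self T x⟩ hx
    refine ⟨φ y, mem_image_of_mem _ hy, ?_⟩
    rw [map_sub, hφ]
    exact hxy

/-- A quadratic form that is small on a `1/8`-net of the unit ball is small everywhere. -/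
theorem abs_sum_mul_sq_le_of_net {ι E F : Type*} [AddCommGroup E] [Module ℝ E]
    [NormedAddCommGroup F] [NormedSpace ℝ F] (T : E →ₗ[ℝ] F) (s : Finset E)
    (hs : ∀ z ∈ s, ‖T z‖ ≤ 1) (hnet : ∀ x, ‖T x‖ ≤ 1 → ∃ z ∈ s, ‖T (x - z)‖ ≤ 1 / 8)
    (I : Finset ι) (c : ι → ℝ) (l : ι → E →ₗ[ℝ] ℝ) {K η : ℝ} (hK0 : 0 ≤ K)
    (hK : ∀ x, |∑ i ∈ I, c i * l i x ^ 2| ≤ K * ‖T x‖ ^ 2)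
    (hη : ∀ z ∈ s, |∑ i ∈ I, c i * l i z ^ 2| ≤ η) (x : E) :
    |∑ i ∈ I, c i * l i x ^ 2| ≤ 2 * η * ‖T x‖ ^ 2 := by
  set D : E → ℝ := fun x => ∑ i ∈ I, c i * l i x ^ 2 with hD
  have hsmul : ∀ (a : ℝ) x, D (a • x) = a ^ 2 * D x := fun a x => by
    simp only [hD, map_smul, smul_eq_mul, mul_sum]
    exact sum_congr rfl fun i _ => by ring
  have hpolar : ∀ x z, D x - D z =
      (1 / 64) * (D ((16 : ℝ) • (x - z) + (x + z)) - D ((16 : ℝ) • (x - z) - (x + z))) :=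
    fun x z => by
      simp only [hD, map_smul, smul_eq_mul, mul_sum, map_sub, map_add, ← sum_sub_distrib]
      exact sum_congr rfl fun i _ => by ring
  have hstep : ∀ K : ℝ, 0 ≤ K → (∀ x, |D x| ≤ K * ‖T x‖ ^ 2) →
      ∀ x, |D x| ≤ (η + K / 2) * ‖T x‖ ^ 2 := by
    intro K hK0 hK
    have hball : ∀ x, ‖T x‖ ≤ 1 → |D x| ≤ η + K / 2 := by
      intro x hx
      obtain ⟨z, hz, hxz⟩ := hnet x hx
      have hh : ‖T ((16 : ℝ) • (x - z))‖ ≤ 2 := by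
        rw [map_smul, norm_smul, Real.norm_of_nonneg (by norm_num)]
        linarith
      have hk : ‖T (x + z)‖ ≤ 2 := by
        rw [map_add]
        linarith [norm_add_le (T x) (T z), hs z hz]
      have hbound : ∀ v, ‖T v‖ ≤ 4 → |D v| ≤ 16 * K := fun v hv => by
        refine (hK v).trans ?_
        have : ‖T v‖ ^ 2 ≤ 4 ^ 2 := by gcongr
        nlinarith
      have hplus := hbound ((16 : ℝ) • (x - z) + (x + z)) (by
        rw [map_add]
        linarith [norm_add_le (T ((16 : ℝ) • (x - z))) (T (x + z))])
      have hminus := hbound ((16 : ℝ) • (x - z) - (x + z)) (by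
        rw [map_sub]
        linarith [norm_sub_le (T ((16 : ℝ) • (x - z))) (T (x + z))])
      have hdiff := hpolar x z
      have hDz := hη z hz
      rw [abs_le] at *
      constructor <;> linarith
    intro x
    rcases (norm_nonneg (T x)).eq_or_lt with h0 | h0
    · have := hK x
      rw [← h0] at this ⊢
      simpa using this
    · have := hball (‖T x‖⁻¹ • x) (by
        rw [map_smul, norm_smul, norm_inv, norm_norm, inv_mul_cancel₀ h0.ne'])
      rw [hsmul, abs_mul, abs_of_nonneg (sq_nonneg _), inv_pow, inv_mul_le_iff₀ (by positivity)]
        at this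
      linarith
  have hη0 : 0 ≤ η := by
    obtain ⟨z, hz, -⟩ := hnet 0 (by simp)
    exact (abs_nonneg _).trans (hη z hz)
  have hiter : ∀ k : ℕ, ∀ x, |D x| ≤ (2 * η + K * (1 / 2) ^ k) * ‖T x‖ ^ 2 := by
    intro k
    induction k with
    | zero =>
      intro x
      refine (hK x).trans ?_
      gcongr
      linarith
    | succ k ih =>
      intro x
      refine (hstep _ (by positivity) ih x).trans_eq ?_
      ring
  have hlim : Filter.Tendsto (fun k : ℕ => (2 * η + K * (1 / 2) ^ k) * ‖T x‖ ^ 2) Filter.atTop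
      (nhds ((2 * η + K * 0) * ‖T x‖ ^ 2)) :=
    (((tendsto_pow_atTop_nhds_zero_of_lt_one (by norm_num) (by norm_num)).const_mul K).const_add
      (2 * η)).mul_const _
  simpa using ge_of_tendsto' hlim fun k => hiter k x

/-- The contribution `max_{u,v ∈ e} (x u - x v)²` of one hyperedge to the quadratic form. -/
noncomputable def edgeSpread {V : Type} (x : V → ℝ) (e : Finset V) : ℝ :=
  if h : e.Nonempty then e.sup' h (fun u => e.sup' h fun v => (x u - x v) ^ 2) else 0

theorem hyperQuadForm_eq_sum {V : Type} [DecidableEq V] (E : Finset (Finset V))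
    (w : Finset V → ℝ) (x : V → ℝ) : hyperQuadForm E w x = ∑ e ∈ E, w e * edgeSpread x e := rfl

theorem sq_sub_le_edgeSpread {V : Type} (x : V → ℝ) {e : Finset V} {a b : V} (ha : a ∈ e)
    (hb : b ∈ e) : (x a - x b) ^ 2 ≤ edgeSpread x e := by
  rw [edgeSpread, dif_pos ⟨a, ha⟩]
  exact (le_sup' (fun v => (x a - x v) ^ 2) hb).trans
    (le_sup' (fun u => e.sup' ⟨a, ha⟩ fun v => (x u - x v) ^ 2) ha)

theorem edgeSpread_nonneg {V : Type} (x : V → ℝ) (e : Finset V) : 0 ≤ edgeSpread x e := by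
  rcases e.eq_empty_or_nonempty with rfl | ⟨a, ha⟩
  · simp [edgeSpread]
  · exact (sq_nonneg _).trans (sq_sub_le_edgeSpread x ha ha)

theorem edgeSpread_eq {V : Type} {x : V → ℝ} {e : Finset V} {u v : V} (hu : u ∈ e) (hv : v ∈ e)
    (hmax : ∀ a ∈ e, x a ≤ x u) (hmin : ∀ a ∈ e, x v ≤ x a) :
    edgeSpread x e = (x u - x v) ^ 2 := by
  refine le_antisymm ?_ (sq_sub_le_edgeSpread x hu hv)
  rw [edgeSpread, dif_pos ⟨u, hu⟩]
  refine sup'_le _ _ fun a ha => sup'_le _ _ fun b hb => sq_le_sq' ?_ ?_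
  · linarith [hmax b hb, hmin a ha]
  · linarith [hmax a ha, hmin b hb]

/-- The hypergraph energy is the squared norm of a linear image of the potential. -/
theorem exists_linearMap_norm_sq_eq {V : Type} [Fintype V] [DecidableEq V]
    (E : Finset (Finset V)) (w : Finset V → ℝ) (hE : ∀ e ∈ E, e.Nonempty)
    (hw : ∀ e ∈ E, 0 ≤ w e) :
    ∃ T : (V → ℝ) →ₗ[ℝ] PiLp 2 (fun _ : Finset V => V × V → ℝ),
      ∀ x, ‖T x‖ ^ 2 = hyperQuadForm E w x := by
  let f : (V → ℝ) → Finset V → V × V → ℝ := fun x e p =>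
    if e ∈ E ∧ p.1 ∈ e ∧ p.2 ∈ e then Real.sqrt (w e) * (x p.1 - x p.2) else 0
  refine ⟨{ toFun := fun x => WithLp.toLp 2 (f x), map_add' := ?_, map_smul' := ?_ }, ?_⟩
  · intro x y
    ext e p
    simp only [f, PiLp.add_apply, Pi.add_apply]
    split_ifs <;> ring
  · intro a x
    ext e p
    simp only [f, PiLp.smul_apply, Pi.smul_apply, smul_eq_mul, RingHom.id_apply]
    split_ifs <;> ring
  · intro x
    rw [PiLp.norm_sq_eq_of_L2, hyperQuadForm_eq_sum, ← sum_subset (subset_univ E)]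
    · refine sum_congr rfl fun e he => ?_
      obtain ⟨u, hu, hmax⟩ := e.exists_max_image x (hE e he)
      obtain ⟨v, hv, hmin⟩ := e.exists_min_image x (hE e he)
      have huv : 0 ≤ x u - x v := sub_nonneg.2 (hmin u hu)
      have hnorm : ‖f x e‖ = Real.sqrt (w e) * (x u - x v) := by
        apply le_antisymm
        · rw [pi_norm_le_iff_of_nonneg (by positivity)]
          rintro ⟨a, b⟩
          simp only [f]
          split_ifs with h
          · rw [norm_mul, Real.norm_of_nonneg (Real.sqrt_nonneg _)]
            refine mul_le_mul_of_nonneg_left ?_ (Real.sqrt_nonneg _)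
            rw [Real.norm_eq_abs, abs_le]
            constructor
            · linarith [hmax b h.2.2, hmin a h.2.1]
            · linarith [hmax a h.2.1, hmin b h.2.2]
          · simpa using mul_nonneg (Real.sqrt_nonneg (w e)) huv
        · refine le_trans (le_of_eq ?_) (norm_le_pi_norm (f x e) (u, v))
          simp only [f, he, hu, hv, and_self, if_true]
          rw [Real.norm_of_nonneg (by positivity)]
      change ‖f x e‖ ^ 2 = _
      rw [hnorm, edgeSpread_eq hu hv hmax hmin, mul_pow, Real.sq_sqrt (hw e he)]
    · intro e _ he
      have : f x e = 0 := by
        funext p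
        simp [f, he]
      change ‖f x e‖ ^ 2 = 0
      simp [this]

/-- Every potential has the same vertex order as one of at most `n ^ n` rank functions, so the
extreme vertices of all hyperedges can be read off from a rank function. -/
theorem exists_extreme_selection (V : Type) [Fintype V] [Nonempty V] :
    ∃ u v : (V → Fin (Fintype.card V)) → Finset V → V,
      (∀ σ, ∀ e : Finset V, e.Nonempty → u σ e ∈ e ∧ v σ e ∈ e) ∧
      ∀ x : V → ℝ, ∃ σ, ∀ e : Finset V, e.Nonempty →
        edgeSpread x e = (x (u σ e) - x (v σ e)) ^ 2 := by
  have hmax : ∀ (σ : V → Fin (Fintype.card V)) (e : Finset V), ∃ a : V, e.Nonempty →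
      a ∈ e ∧ ∀ b ∈ e, σ b ≤ σ a := by
    intro σ e
    by_cases he : e.Nonempty
    · obtain ⟨a, ha⟩ := e.exists_max_image σ he
      exact ⟨a, fun _ => ha⟩
    · exact ⟨Classical.arbitrary V, fun h => absurd h he⟩
  have hmin : ∀ (σ : V → Fin (Fintype.card V)) (e : Finset V), ∃ a : V, e.Nonempty →
      a ∈ e ∧ ∀ b ∈ e, σ a ≤ σ b := by
    intro σ e
    by_cases he : e.Nonempty
    · obtain ⟨a, ha⟩ := e.exists_min_image σ he
      exact ⟨a, fun _ => ha⟩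
    · exact ⟨Classical.arbitrary V, fun h => absurd h he⟩
  choose u hu using hmax
  choose v hv using hmin
  refine ⟨u, v, fun σ e he => ⟨(hu σ e he).1, (hv σ e he).1⟩, fun x => ?_⟩
  let σ : V → Fin (Fintype.card V) := fun a =>
    ⟨({b | x b < x a} : Finset V).card, card_lt_univ_of_notMem (x := a) (by simp)⟩
  have hσ : ∀ a b, σ a ≤ σ b → x a ≤ x b := by
    intro a b hab
    by_contra! hlt
    have hss : ({c | x c < x b} : Finset V) ⊂
        ({c | x c < x a} : Finset V) := by
      refine (ssubset_iff_of_subset fun c hc => ?_).2 ⟨b, by simpa using hlt, by simp⟩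
      simp only [mem_filter, mem_univ, true_and] at hc ⊢
      exact hc.trans hlt
    exact absurd (Fin.le_def.1 hab) (not_le.2 (card_lt_card hss))
  exact ⟨σ, fun e he => edgeSpread_eq (hu σ e he).1 (hv σ e he).1
    (fun a ha => hσ _ _ ((hu σ e he).2 a ha)) (fun a ha => hσ _ _ ((hv σ e he).2 a ha))⟩

/-- Leverage of a hyperedge: `r e` dominates the energy share of `e`, and the total weighted
leverage is at most `n²`. -/
theorem exists_leverage {V : Type} [Fintype V] [DecidableEq V]
    (E : Finset (Finset V)) (w : Finset V → ℝ) (hE : ∀ e ∈ E, e.Nonempty)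
    (hw : ∀ e ∈ E, 0 < w e) :
    ∃ r : Finset V → ℝ, (∀ e ∈ E, 0 < r e) ∧
      ∑ e ∈ E, w e * r e ≤ (Fintype.card V : ℝ) ^ 2 ∧
      ∀ x, ∀ e ∈ E, edgeSpread x e ≤ r e * hyperQuadForm E w x := by
  let W : V × V → ℝ := fun p => ∑ e ∈ E with p ∈ e ×ˢ e, w e
  have hWnonneg : ∀ p, 0 ≤ W p := fun p =>
    sum_nonneg fun e he => (hw e (mem_filter.1 he).1).le
  have hWpos : ∀ e ∈ E, ∀ p ∈ e ×ˢ e, 0 < W p := fun e he p hp =>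
    sum_pos (fun e he => hw e (mem_filter.1 he).1) ⟨e, mem_filter.2 ⟨he, hp⟩⟩
  refine ⟨fun e => ∑ p ∈ e ×ˢ e, (W p)⁻¹, ?_, ?_, ?_⟩
  · exact fun e he => sum_pos (fun p hp => inv_pos.2 (hWpos e he p hp))
      ((hE e he).product (hE e he))
  · calc ∑ e ∈ E, w e * ∑ p ∈ e ×ˢ e, (W p)⁻¹
        = ∑ e ∈ E, ∑ p, if p ∈ e ×ˢ e then w e * (W p)⁻¹ else 0 := by
          refine sum_congr rfl fun e _ => ?_
          rw [mul_sum, ← sum_filter]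
          exact sum_congr (by ext; simp) fun _ _ => rfl
      _ = ∑ p, W p * (W p)⁻¹ := by
          rw [sum_comm]
          refine sum_congr rfl fun p _ => ?_
          rw [← sum_filter, ← sum_mul]
      _ ≤ ∑ _p : V × V, (1 : ℝ) := sum_le_sum fun p _ => mul_inv_le_one
      _ = (Fintype.card V : ℝ) ^ 2 := by simp [sq]
  · intro x e he
    obtain ⟨u, hu, hmax⟩ := e.exists_max_image x (hE e he)
    obtain ⟨v, hv, hmin⟩ := e.exists_min_image x (hE e he)
    have huv : (u, v) ∈ e ×ˢ e := mem_product.2 ⟨hu, hv⟩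
    have hQ : W (u, v) * (x u - x v) ^ 2 ≤ hyperQuadForm E w x := by
      rw [hyperQuadForm_eq_sum, sum_mul]
      calc ∑ f ∈ E with (u, v) ∈ f ×ˢ f, w f * (x u - x v) ^ 2
          ≤ ∑ f ∈ E with (u, v) ∈ f ×ˢ f, w f * edgeSpread x f := by
            refine sum_le_sum fun f hf => ?_
            obtain ⟨hfE, hf⟩ := mem_filter.1 hf
            obtain ⟨hfu, hfv⟩ := mem_product.1 hf
            exact mul_le_mul_of_nonneg_left (sq_sub_le_edgeSpread x hfu hfv) (hw f hfE).le
        _ ≤ ∑ f ∈ E, w f * edgeSpread x f :=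
            sum_le_sum_of_subset_of_nonneg (filter_subset _ _) fun f hf _ =>
              mul_nonneg (hw f hf).le (edgeSpread_nonneg x f)
    have hQ0 : 0 ≤ hyperQuadForm E w x := (mul_nonneg (hWnonneg _) (sq_nonneg _)).trans hQ
    calc edgeSpread x e = (x u - x v) ^ 2 := edgeSpread_eq hu hv hmax hmin
      _ ≤ (W (u, v))⁻¹ * hyperQuadForm E w x := by
          rw [inv_mul_eq_div, le_div_iff₀ (hWpos e he _ huv)]
          linarith
      _ ≤ _ := mul_le_mul_of_nonneg_right
          (single_le_sum (f := fun p => (W p)⁻¹) (fun p _ => inv_nonneg.2 (hWnonneg p)) huv) hQ0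

/-- The number of test functions needed is `exp (O(n log n))`. -/
theorem log_two_mul_card_pow_mul_le {n : ℕ} (hn : 2 ≤ n) :
    Real.log (2 * (n ^ n * 17 ^ n)) ≤ 7 * n * Real.log n := by
  have hn' : (2 : ℝ) ≤ n := by exact_mod_cast hn
  have hle : (2 * (n ^ n * 17 ^ n) : ℝ) ≤ (n : ℝ) ^ (7 * n) := by
    calc (2 * (n ^ n * 17 ^ n) : ℝ) ≤ (n : ℝ) ^ n * (n ^ n * ((n : ℝ) ^ 5) ^ n) := by
          gcongr
          · exact hn'.trans (le_self_pow₀ (by linarith) (by omega))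
          · calc (17 : ℝ) ≤ 2 ^ 5 := by norm_num
              _ ≤ (n : ℝ) ^ 5 := by gcongr
      _ = (n : ℝ) ^ (7 * n) := by
          rw [← pow_mul, ← pow_add, ← pow_add]
          congr 1
          omega
  calc Real.log (2 * (n ^ n * 17 ^ n)) ≤ Real.log ((n : ℝ) ^ (7 * n)) :=
        Real.log_le_log (by positivity) hle
    _ = 7 * n * Real.log n := by
        rw [Real.log_pow]
        push_cast
        ring

/-- Two-sided approximation for hypergraphs with positive weights. -/
theorem exists_sparse_approx {V : Type} [Fintype V] [DecidableEq V]
    (E : Finset (Finset V)) (w : Finset V → ℝ) (hE : ∀ e ∈ E, e.Nonempty)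
    (hw : ∀ e ∈ E, 0 < w e) (hn : 2 ≤ Fintype.card V) {ε : ℝ} (hε : 0 < ε) (hε1 : ε < 1) (m : ℕ)
    (hm : 448 * (Fintype.card V : ℝ) ^ 3 * Real.log (Fintype.card V) / ε ^ 2 ≤ m) :
    ∃ (E' : Finset (Finset V)) (c : Finset V → ℝ), E' ⊆ E ∧ (∀ e ∈ E', 0 ≤ c e) ∧
      E'.card ≤ m ∧ ∀ x, |hyperQuadForm E' c x - hyperQuadForm E w x| ≤
        ε / 2 * hyperQuadForm E w x := by
  have : Nonempty V := Fintype.card_pos_iff.1 (by omega)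
  obtain ⟨T, hT⟩ := exists_linearMap_norm_sq_eq E w hE fun e he => (hw e he).le
  obtain ⟨s, hcard, hs, hnet⟩ := exists_net_comap T
  rw [Module.finrank_fintype_fun_eq_card] at hcard
  obtain ⟨u, v, huv, hsel⟩ := exists_extreme_selection V
  obtain ⟨r, hr, hrsum, hrQ⟩ := exists_leverage E w hE hw
  obtain ⟨z₀, hz₀, -⟩ := hnet 0 (by simp)
  have : Nonempty s := ⟨⟨z₀, hz₀⟩⟩
  have hselle : ∀ σ, ∀ e ∈ E, ∀ x : V → ℝ, (x (u σ e) - x (v σ e)) ^ 2 ≤ edgeSpread x e :=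
    fun σ e he x => sq_sub_le_edgeSpread x (huv σ e (hE e he)).1 (huv σ e (hE e he)).2
  have hQs : ∀ z ∈ s, hyperQuadForm E w z ≤ 1 := fun z hz => by
    rw [← hT]
    exact pow_le_one₀ (norm_nonneg _) (hs z hz)
  obtain ⟨E', c, hE', hc, hcardE', happrox⟩ := exists_sparse_reweighting
    (J := (V → Fin (Fintype.card V)) × s) E w r hw hr
    (fun j e => ((j.2 : V → ℝ) (u j.1 e) - (j.2 : V → ℝ) (v j.1 e)) ^ 2)
    (fun j e _ => sq_nonneg _)
    (fun j e he => by
      refine (hselle j.1 e he _).trans ((hrQ j.2 e he).trans ?_)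
      exact mul_le_of_le_one_right (hr e he).le (hQs _ j.2.2))
    (fun j => by
      refine le_trans (sum_le_sum fun e he => ?_) (hQs _ j.2.2)
      exact mul_le_mul_of_nonneg_left (hselle j.1 e he _) (hw e he).le)
    hrsum (δ := ε / 4) (by positivity) (by linarith) m (by
      refine le_trans ?_ hm
      have hJ : Real.log (2 * Fintype.card ((V → Fin (Fintype.card V)) × s)) ≤
          7 * Fintype.card V * Real.log (Fintype.card V) := by
        refine le_trans (Real.log_le_log ?_ ?_) (log_two_mul_card_pow_mul_le hn)
        · have : (0 : ℝ) < Fintype.card ((V → Fin (Fintype.card V)) × s) := by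
            exact_mod_cast Fintype.card_pos
          positivity
        · have : (s.card : ℝ) ≤ 17 ^ Fintype.card V := by exact_mod_cast hcard
          simp only [Fintype.card_prod, Fintype.card_fun, Fintype.card_fin, Fintype.card_coe]
          push_cast
          gcongr
      calc _ ≤ 4 * (Fintype.card V : ℝ) ^ 2 *
            (7 * Fintype.card V * Real.log (Fintype.card V)) / (ε / 4) ^ 2 := by gcongr
        _ = _ := by
          field_simp
          ring)
  refine ⟨E', c, hE', hc, hcardE', fun x => ?_⟩
  obtain ⟨σ, hσ⟩ := hsel x
  let d : Finset V → ℝ := fun e => (if e ∈ E' then c e else 0) - w e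
  let l : Finset V → (V → ℝ) →ₗ[ℝ] ℝ := fun e =>
    (LinearMap.proj (u σ e) : (V → ℝ) →ₗ[ℝ] ℝ) - LinearMap.proj (v σ e)
  have hd : ∀ φ : Finset V → ℝ,
      ∑ e ∈ E, d e * φ e = ∑ e ∈ E', c e * φ e - ∑ e ∈ E, w e * φ e := by
    intro φ
    simp only [d, sub_mul, sum_sub_distrib, ite_mul, zero_mul]
    rw [← sum_filter, filter_mem_eq_inter, inter_eq_right.2 hE']
  have hform := abs_sum_mul_sq_le_of_net T s hs hnet E d l
    (K := ∑ e ∈ E, |d e| * r e) (η := ε / 4)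
    (sum_nonneg fun e he => mul_nonneg (abs_nonneg _) (hr e he).le)
    (fun y => by
      rw [hT, sum_mul]
      refine (abs_sum_le_sum_abs _ _).trans (sum_le_sum fun e he => ?_)
      rw [abs_mul, abs_of_nonneg (sq_nonneg (l e y)), mul_assoc]
      exact mul_le_mul_of_nonneg_left ((hselle σ e he y).trans (hrQ y e he)) (abs_nonneg _))
    (fun z hz => by
      rw [hd]
      exact happrox (σ, ⟨z, hz⟩)) x
  have hspread : ∑ e ∈ E, d e * l e x ^ 2 = ∑ e ∈ E, d e * edgeSpread x e :=
    sum_congr rfl fun e he => by rw [hσ e (hE e he)]; rfl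
  rw [hspread, hd, hT] at hform
  rw [hyperQuadForm_eq_sum E' c]
  refine hform.trans_eq ?_
  ring

/-- Every weighted undirected hypergraph on `n ≥ 2` vertices admits, for every
`ε ∈ (0,1)`, an ε-spectral sparsifier with `O(n³ log n / ε²)` hyperedges. -/
theorem undirected_hypergraph_spectral_sparsifier :
    ∃ C : ℝ, 0 < C ∧
      ∀ (V : Type) [Fintype V] [DecidableEq V]
        (E : Finset (Finset V)) (w : Finset V → ℝ),
        (∀ e ∈ E, e.Nonempty) → (∀ e ∈ E, 0 ≤ w e) →
        2 ≤ Fintype.card V →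
        ∀ ε : ℝ, 0 < ε → ε < 1 →
        ∃ (E' : Finset (Finset V)) (w' : Finset V → ℝ),
          E' ⊆ E ∧ (∀ e ∈ E', 0 ≤ w' e) ∧
          (E'.card : ℝ) ≤
            C * (Fintype.card V : ℝ) ^ 3 * Real.log (Fintype.card V) / ε ^ 2 ∧
          ∀ x : V → ℝ,
            (1 - ε) * hyperQuadForm E' w' x ≤ hyperQuadForm E w x ∧
            hyperQuadForm E w x ≤ (1 + ε) * hyperQuadForm E' w' x := by
  refine ⟨500, by norm_num, ?_⟩
  intro V _ _ E w hE hw hn ε hε hε1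
  have hn' : (2 : ℝ) ≤ Fintype.card V := by exact_mod_cast hn
  set B : ℝ := (Fintype.card V : ℝ) ^ 3 * Real.log (Fintype.card V) / ε ^ 2 with hB
  have hB1 : 1 ≤ B := by
    have hlog : 1 / 2 ≤ Real.log (Fintype.card V) :=
      le_trans (by linarith [Real.log_two_gt_d9]) (Real.log_le_log (by norm_num) hn')
    have hcube : (2 : ℝ) ^ 3 ≤ (Fintype.card V : ℝ) ^ 3 := by gcongr
    rw [hB, one_le_div (by positivity)]
    have : ε ^ 2 ≤ 1 := pow_le_one₀ hε.le hε1.le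
    nlinarith
  obtain ⟨E', c, hE', hc, hcard, happrox⟩ := exists_sparse_approx (E.filter fun e => 0 < w e) w
    (fun e he => hE e (mem_filter.1 he).1) (fun e he => (mem_filter.1 he).2) hn hε hε1
    ⌈448 * B⌉₊ (le_trans (le_of_eq (by rw [hB]; ring)) (Nat.le_ceil _))
  have hfilter : ∀ x, hyperQuadForm (E.filter fun e => 0 < w e) w x = hyperQuadForm E w x := by
    intro x
    refine sum_subset (filter_subset _ _) fun e he hne => ?_
    have : w e = 0 := le_antisymm (not_lt.1 fun h => hne (mem_filter.2 ⟨he, h⟩)) (hw e he)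
    rw [this, zero_mul]
  refine ⟨E', c, hE'.trans (filter_subset _ _), hc, ?_, fun x => ?_⟩
  · calc (E'.card : ℝ) ≤ (⌈448 * B⌉₊ : ℝ) := by exact_mod_cast hcard
      _ ≤ 448 * B + 1 := (Nat.ceil_lt_add_one (by positivity)).le
      _ ≤ 500 * B := by linarith
      _ = _ := by rw [hB]; ring
  · have hQ : 0 ≤ hyperQuadForm E w x :=
      sum_nonneg fun e he => mul_nonneg (hw e he) (edgeSpread_nonneg x e)
    have hx := happrox x
    rw [hfilter, abs_le] at hx
    constructor
    · nlinarith [mul_nonneg hε.le hQ, mul_nonneg (mul_nonneg hε.le hε.le) hQ]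
    · nlinarith [mul_nonneg hε.le hQ, mul_nonneg (mul_nonneg hε.le (sub_pos.2 hε1).le) hQ]
end

section
/- There is an absolute constant C > 0 such that for every weighted directed hypergraph G = (V, E, w) on a finite vertex set V with n = |V| ≥ 2 vertices and every ε ∈ (0,1), there exists a weighted subhypergraph H of G with at most C · n³ · (log n) / ε² hyperarcs that is an ε-spectral sparsifier of G. -/
open Finset

/-- The Laplacian quadratic form of a weighted directed hypergraph whose hyperarcs
`e = (T_e, H_e)` form the finite set `E`, with weights `w`:
`Q(x) = Σ_{e ∈ E} w(e) · max_{u ∈ T_e, v ∈ H_e} ([x(u) - x(v)]⁺)²`. -/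
noncomputable def dirHyperQuadForm {V : Type} [DecidableEq V]
    (E : Finset (Finset V × Finset V)) (w : Finset V × Finset V → ℝ) (x : V → ℝ) : ℝ :=
  ∑ e ∈ E, w e *
    (if h : e.1.Nonempty ∧ e.2.Nonempty then
      e.1.sup' h.1 (fun u => e.2.sup' h.2 fun v => (max (x u - x v) 0) ^ 2) else 0)

/-- Derandomized sampling: if each of finitely many nonnegative functions has mean at most `1`,
some sequence keeps the sum of their products along the sequence at most their number. -/
theorem exists_seq_sum_prod_le {ι A : Type*} (E : Finset ι) (p : ι → ℝ)
    (hp : ∀ i ∈ E, 0 < p i) (hp1 : ∑ i ∈ E, p i = 1) (J : Finset A) (g : A → ι → ℝ)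
    (hg : ∀ a i, 0 ≤ g a i) (hm : ∀ a ∈ J, ∑ i ∈ E, p i * g a i ≤ 1) (M : ℕ) :
    ∃ f : ℕ → ι, (∀ k, f k ∈ E) ∧ ∑ a ∈ J, ∏ k ∈ range M, g a (f k) ≤ (J.card : ℝ) := by
  have hne : E.Nonempty := by
    rw [nonempty_iff_ne_empty]
    rintro rfl
    simp at hp1
  induction M with
  | zero =>
    obtain ⟨i, hi⟩ := hne
    exact ⟨fun _ => i, fun _ => hi, by simp⟩
  | succ M ih =>
    obtain ⟨f, hf, hsum⟩ := ih
    set c : A → ℝ := fun a => ∏ k ∈ range M, g a (f k) with hc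
    have hc0 : ∀ a, 0 ≤ c a := fun a => prod_nonneg fun k _ => hg a _
    obtain ⟨i, hi, hle⟩ : ∃ i ∈ E, p i * ∑ a ∈ J, c a * g a i ≤ p i * ∑ a ∈ J, c a := by
      apply exists_le_of_sum_le hne
      rw [← sum_mul, hp1, one_mul]
      calc ∑ i ∈ E, p i * ∑ a ∈ J, c a * g a i
          = ∑ a ∈ J, c a * ∑ i ∈ E, p i * g a i := by
            simp_rw [mul_sum]
            rw [sum_comm]
            exact sum_congr rfl fun a _ => sum_congr rfl fun i _ => by ring
        _ ≤ ∑ a ∈ J, c a :=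
            sum_le_sum fun a ha => mul_le_of_le_one_right (hc0 a) (hm a ha)
    refine ⟨Function.update f M i, fun k => ?_, ?_⟩
    · rcases eq_or_ne k M with rfl | hk
      · simpa using hi
      · simpa [hk] using hf k
    · have hprod : ∀ a, ∏ k ∈ range (M + 1), g a (Function.update f M i k) = c a * g a i := by
        intro a
        rw [prod_range_succ, Function.update_self]
        congr 1
        refine prod_congr rfl fun k hk => ?_
        rw [Function.update_of_ne (mem_range.1 hk).ne]
      simp_rw [hprod]
      exact (le_of_mul_le_mul_left hle (hp i hi)).trans hsum

theorem exp_le_one_add_add_sq {t : ℝ} (ht : |t| ≤ 1) : Real.exp t ≤ 1 + t + t ^ 2 := by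
  have := (abs_le.1 (Real.abs_exp_sub_one_sub_id_le ht)).2
  linarith

/-- Moment generating function bound for a variable with values in `[0, R]` and mean `m ≤ 1`. -/
theorem sum_mul_exp_le_one {ι : Type*} (E : Finset ι) (p X : ι → ℝ) {R m l : ℝ}
    (hp : ∀ i ∈ E, 0 < p i) (hp1 : ∑ i ∈ E, p i = 1) (hX0 : ∀ i ∈ E, 0 ≤ X i)
    (hXR : ∀ i ∈ E, X i ≤ R) (hR : 0 ≤ R) (hmean : ∑ i ∈ E, p i * X i = m) (hm : m ≤ 1)
    (hl : |l| * R ≤ 1) :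
    ∑ i ∈ E, p i * Real.exp (l * (X i - m) - l ^ 2 * R) ≤ 1 := by
  have hexp : ∀ i ∈ E, p i * Real.exp (l * X i) ≤ p i * (1 + (l + l ^ 2 * R) * X i) := by
    intro i hi
    refine mul_le_mul_of_nonneg_left ?_ (hp i hi).le
    have habs : |l * X i| ≤ 1 := by
      rw [abs_mul, abs_of_nonneg (hX0 i hi)]
      exact (mul_le_mul_of_nonneg_left (hXR i hi) (abs_nonneg l)).trans hl
    refine (exp_le_one_add_add_sq habs).trans ?_
    nlinarith [mul_nonneg (sq_nonneg l) (mul_nonneg (hX0 i hi) (sub_nonneg.2 (hXR i hi)))]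
  calc ∑ i ∈ E, p i * Real.exp (l * (X i - m) - l ^ 2 * R)
      = (∑ i ∈ E, p i * Real.exp (l * X i)) * Real.exp (-(l * m + l ^ 2 * R)) := by
        rw [sum_mul]
        refine sum_congr rfl fun i _ => ?_
        rw [mul_assoc, ← Real.exp_add]
        ring_nf
    _ ≤ Real.exp (l * m + l ^ 2 * R) * Real.exp (-(l * m + l ^ 2 * R)) := by
        refine mul_le_mul_of_nonneg_right ?_ (Real.exp_pos _).le
        calc ∑ i ∈ E, p i * Real.exp (l * X i)
            ≤ ∑ i ∈ E, p i * (1 + (l + l ^ 2 * R) * X i) := sum_le_sum hexp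
          _ = 1 + (l + l ^ 2 * R) * m := by
            simp_rw [mul_add, mul_one, sum_add_distrib, hp1, ← hmean, mul_sum]
            exact congrArg _ (sum_congr rfl fun i _ => by ring)
          _ ≤ l * m + l ^ 2 * R + 1 := by
            nlinarith [mul_nonneg (mul_nonneg (sq_nonneg l) hR) (sub_nonneg.2 hm)]
          _ ≤ _ := Real.add_one_le_exp _
    _ = 1 := by rw [← Real.exp_add, add_neg_cancel, Real.exp_zero]

/-- Simultaneous relative-error approximation of the means of finitely many nonnegative functions
by averages over a common sequence. -/
theorem exists_seq_abs_sum_sub_le {ι A : Type*} (E : Finset ι) (p : ι → ℝ)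
    (hp : ∀ i ∈ E, 0 < p i) (hp1 : ∑ i ∈ E, p i = 1) (J : Finset A) (Y : A → ι → ℝ)
    (κ : A → ℝ) {R δ : ℝ} (hR : 0 < R) (hδ : 0 < δ) (hδ1 : δ ≤ 1)
    (hY0 : ∀ a ∈ J, ∀ i ∈ E, 0 ≤ Y a i) (hYR : ∀ a ∈ J, ∀ i ∈ E, Y a i ≤ R * κ a)
    (hmean : ∀ a ∈ J, ∑ i ∈ E, p i * Y a i = κ a) (M : ℕ)
    (hM : Real.log (2 * J.card) ≤ M * (δ ^ 2 / (4 * R))) :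
    ∃ f : ℕ → ι, (∀ k, f k ∈ E) ∧
      ∀ a ∈ J, |∑ k ∈ range M, Y a (f k) - M * κ a| ≤ δ * (M * κ a) := by
  have hκ0 : ∀ a ∈ J, 0 ≤ κ a := fun a ha => by
    rw [← hmean a ha]
    exact sum_nonneg fun i hi => mul_nonneg (hp i hi).le (hY0 a ha i hi)
  set l : ℝ := δ / (2 * R) with hl
  have hlpos : 0 < l := by positivity
  have hlR : l * R = δ / 2 := by rw [hl]; field_simp
  have hmgf : ∀ s : ℝ, |s| = l → ∀ a ∈ J,
      ∑ i ∈ E, p i * Real.exp (s * (Y a i / κ a - κ a / κ a) - s ^ 2 * R) ≤ 1 := by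
    intro s hs a ha
    refine sum_mul_exp_le_one E p _ hp hp1
      (fun i hi => div_nonneg (hY0 a ha i hi) (hκ0 a ha))
      (fun i hi => div_le_of_le_mul₀ (hκ0 a ha) hR.le (hYR a ha i hi)) hR.le ?_
      (div_self_le_one _) (by rw [hs, hlR]; linarith)
    rw [← hmean a ha, sum_div]
    exact sum_congr rfl fun i _ => by rw [mul_div_assoc]
  obtain ⟨f, hfE, hf⟩ := exists_seq_sum_prod_le E p hp hp1 (J ×ˢ (univ : Finset Bool))
    (fun a i => Real.exp ((if a.2 then l else -l) * (Y a.1 i / κ a.1 - κ a.1 / κ a.1)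
      - (if a.2 then l else -l) ^ 2 * R)) (fun _ _ => (Real.exp_pos _).le)
    (fun a ha => hmgf _ (by split_ifs <;> simp [abs_of_pos hlpos]) _ (mem_product.1 ha).1) M
  refine ⟨f, hfE, fun a ha => ?_⟩
  rcases (hκ0 a ha).eq_or_lt with h0 | hpos
  · have hz : ∀ k ∈ range M, Y a (f k) = 0 := fun k _ =>
      le_antisymm (by simpa [← h0] using hYR a ha _ (hfE k)) (hY0 a ha _ (hfE k))
    simp [sum_eq_zero hz, ← h0]
  have key : ∀ b : Bool, (if b then l else -l) * (∑ k ∈ range M, Y a (f k) / κ a - M)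
      ≤ l * (M * δ) := by
    intro b
    have hle := (single_le_sum (f := fun a : A × Bool => ∏ k ∈ range M,
      Real.exp ((if a.2 then l else -l) * (Y a.1 (f k) / κ a.1 - κ a.1 / κ a.1)
      - (if a.2 then l else -l) ^ 2 * R))
      (fun _ _ => prod_nonneg fun _ _ => (Real.exp_pos _).le)
      (a := (a, b)) (mem_product.2 ⟨ha, mem_univ b⟩)).trans hf
    rw [← Real.exp_sum, div_self hpos.ne'] at hle
    have hlog := (Real.le_log_iff_exp_le (lt_of_lt_of_le (Real.exp_pos _) hle)).2 hle
    have hcard : ((J ×ˢ (univ : Finset Bool)).card : ℝ) = 2 * J.card := by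
      simp [card_product, mul_comm]
    have hsq : (if b then l else -l) ^ 2 = l ^ 2 := by cases b <;> simp
    rw [hcard] at hlog
    simp only [hsq, sum_sub_distrib, ← mul_sum, sum_const, card_range, nsmul_eq_mul,
      mul_one] at hlog
    have h1 : M * (δ ^ 2 / (4 * R)) + M * (l ^ 2 * R) = l * (M * δ) := by
      rw [hl]; field_simp; ring
    linarith
  have hup := key true
  have hlow := key false
  simp only [if_true, Bool.false_eq_true, if_false] at hup hlow
  have hup' := le_of_mul_le_mul_left hup hlpos
  have hlow' : M - ∑ k ∈ range M, Y a (f k) / κ a ≤ M * δ :=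
    le_of_mul_le_mul_left (by linarith) hlpos
  rw [← sum_div] at hup' hlow'
  have hS : (∑ k ∈ range M, Y a (f k)) / κ a * κ a = ∑ k ∈ range M, Y a (f k) :=
    div_mul_cancel₀ _ hpos.ne'
  rw [abs_le]
  constructor <;> nlinarith

/-- Every element of a nonempty finite set of reals is the least element plus a sum of nonnegative
gaps indexed by the smaller elements. -/
theorem exists_gaps (L : Finset ℝ) :
    ∃ (d : ℝ → ℝ) (c : ℝ), (∀ s, 0 ≤ d s) ∧ (L.Nonempty → c ∈ L) ∧
      ∀ a ∈ L, a = c + ∑ s ∈ L, if s < a then d s else 0 := by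
  induction L using Finset.induction_on_min with
  | empty => exact ⟨0, 0, by simp, by simp, by simp⟩
  | insert m L hm ih =>
    obtain ⟨d, c, hd, hc, h⟩ := ih
    have hmL : m ∉ L := fun hmem => lt_irrefl _ (hm m hmem)
    have hsum : ∀ (z a : ℝ), (∑ s ∈ L, if s < a then Function.update d m z s else 0) =
        ∑ s ∈ L, if s < a then d s else 0 := fun z a => sum_congr rfl fun s hs => by
      rw [Function.update_of_ne (hm s hs).ne']
    refine ⟨Function.update d m (max (c - m) 0), m, fun s => ?_, by simp, fun a ha => ?_⟩
    · rcases eq_or_ne s m with rfl | hs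
      · simp
      · simpa [hs] using hd s
    · rw [sum_insert hmL, hsum]
      rcases mem_insert.1 ha with rfl | haL
      · rw [sum_eq_zero fun s hs => if_neg (hm s hs).not_gt]
        simp
      · have hcm := hm c (hc ⟨a, haL⟩)
        rw [if_pos (hm a haL), Function.update_self, max_eq_left (by linarith)]
        linarith [h a haL]

/-- The positive part of a difference of two elements is the sum of the gaps between them. -/
theorem exists_gaps_posPart (L : Finset ℝ) :
    ∃ d : ℝ → ℝ, (∀ s, 0 ≤ d s) ∧ ∀ a ∈ L, ∀ b ∈ L,
      max (a - b) 0 = ∑ s ∈ L, if b ≤ s ∧ s < a then d s else 0 := by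
  obtain ⟨d, c, hd, -, h⟩ := exists_gaps L
  refine ⟨d, hd, fun a ha b hb => ?_⟩
  rcases le_total a b with hab | hab
  · rw [max_eq_right (by linarith), sum_eq_zero]
    rintro s -
    exact if_neg fun hs => by linarith [hs.1, hs.2]
  · rw [max_eq_left (by linarith)]
    have hdiff : a - b = (∑ s ∈ L, if s < a then d s else 0)
        - ∑ s ∈ L, if s < b then d s else 0 := by
      linarith [h a ha, h b hb]
    rw [hdiff, ← sum_sub_distrib]
    refine sum_congr rfl fun s _ => ?_
    by_cases h1 : s < b
    · simp [h1, h1.trans_le hab]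
    · simp [h1, not_lt.1 h1]

section Hypergraph

variable {V : Type}

/-- The contribution of a hyperarc of unit weight to the Laplacian quadratic form. -/
noncomputable def arcEnergy (e : Finset V × Finset V) (x : V → ℝ) : ℝ :=
  if h : e.1.Nonempty ∧ e.2.Nonempty then
    e.1.sup' h.1 (fun u => e.2.sup' h.2 fun v => (max (x u - x v) 0) ^ 2) else 0

/-- The hyperarc `e` has a tail vertex in `c.1` and a head vertex in `c.2`. -/
def Crosses (c e : Finset V × Finset V) : Prop :=
  (∃ u ∈ e.1, u ∈ c.1) ∧ ∃ v ∈ e.2, v ∈ c.2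

open Classical in
/-- The energy of hyperarcs is a fixed nonnegative combination of crossing indicators. -/
theorem exists_arcEnergy_eq_sum_crosses [Fintype V] (x : V → ℝ) :
    ∃ (K : Finset (ℝ × ℝ)) (a : ℝ × ℝ → ℝ) (c : ℝ × ℝ → Finset V × Finset V),
      (∀ k, 0 ≤ a k) ∧ ∀ e : Finset V × Finset V, e.1.Nonempty ∧ e.2.Nonempty →
        arcEnergy e x = ∑ k ∈ K, a k * if Crosses (c k) e then 1 else 0 := by
  obtain ⟨d, hd, h⟩ := exists_gaps_posPart (univ.image x)
  refine ⟨univ.image x ×ˢ univ.image x, fun k => d k.1 * d k.2,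
    fun k => (univ.filter fun u => k.1 < x u ∧ k.2 < x u,
      univ.filter fun v => x v ≤ k.1 ∧ x v ≤ k.2),
    fun k => mul_nonneg (hd _) (hd _), fun e he => ?_⟩
  obtain ⟨u, hu, hmax⟩ := exists_max_image e.1 x he.1
  obtain ⟨v, hv, hmin⟩ := exists_min_image e.2 x he.2
  have henergy : arcEnergy e x = (max (x u - x v) 0) ^ 2 := by
    rw [arcEnergy, dif_pos he]
    apply le_antisymm
    · refine sup'_le _ _ fun u' hu' => sup'_le _ _ fun v' hv' => ?_
      have := hmax u' hu'
      have := hmin v' hv'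
      gcongr
    · exact (le_sup' (fun v => (max (x u - x v) 0) ^ 2) hv).trans
        (le_sup' (fun u => e.2.sup' he.2 fun v => (max (x u - x v) 0) ^ 2) hu)
  rw [henergy, h _ (mem_image_of_mem x (mem_univ u)) _ (mem_image_of_mem x (mem_univ v)), sq,
    sum_mul_sum, ← sum_product']
  refine sum_congr rfl fun k _ => ?_
  have hiff : Crosses (univ.filter fun u => k.1 < x u ∧ k.2 < x u,
      univ.filter fun v => x v ≤ k.1 ∧ x v ≤ k.2) e ↔
      (x v ≤ k.1 ∧ k.1 < x u) ∧ (x v ≤ k.2 ∧ k.2 < x u) := by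
    simp only [Crosses, mem_filter, mem_univ, true_and]
    constructor
    · rintro ⟨⟨u', hu', h1, h2⟩, v', hv', h3, h4⟩
      have := hmax u' hu'
      have := hmin v' hv'
      exact ⟨⟨by linarith, by linarith⟩, by linarith, by linarith⟩
    · rintro ⟨⟨h1, h2⟩, h3, h4⟩
      exact ⟨⟨u, hu, h2, h4⟩, v, hv, h1, h3⟩
  simp only [hiff]
  by_cases h1 : x v ≤ k.1 ∧ k.1 < x u <;> by_cases h2 : x v ≤ k.2 ∧ k.2 < x u <;>
    simp [h1, h2]

/-- Two weightings agreeing on all crossing sums up to relative error `δ` have Laplacian quadratic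
forms agreeing up to relative error `δ`. -/
theorem abs_sum_arcEnergy_sub_le [Fintype V] (E E' : Finset (Finset V × Finset V))
    (w w' : Finset V × Finset V → ℝ) (δ : ℝ) (hE : ∀ e ∈ E, e.1.Nonempty ∧ e.2.Nonempty)
    (hE' : ∀ e ∈ E', e.1.Nonempty ∧ e.2.Nonempty)
    (h : ∀ c, open Classical in
      |∑ e ∈ E', w' e * (if Crosses c e then 1 else 0)
        - ∑ e ∈ E, w e * (if Crosses c e then 1 else 0)| ≤
      δ * ∑ e ∈ E, w e * (if Crosses c e then 1 else 0)) (x : V → ℝ) :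
    |∑ e ∈ E', w' e * arcEnergy e x - ∑ e ∈ E, w e * arcEnergy e x| ≤
      δ * ∑ e ∈ E, w e * arcEnergy e x := by
  classical
  obtain ⟨K, a, c, ha, hK⟩ := exists_arcEnergy_eq_sum_crosses x
  have hswap : ∀ (F : Finset (Finset V × Finset V)) (z : Finset V × Finset V → ℝ),
      (∀ e ∈ F, e.1.Nonempty ∧ e.2.Nonempty) → ∑ e ∈ F, z e * arcEnergy e x =
        ∑ k ∈ K, a k * ∑ e ∈ F, z e * (if Crosses (c k) e then 1 else 0) := by
    intro F z hF
    simp_rw [mul_sum]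
    rw [sum_comm]
    refine sum_congr rfl fun e he => ?_
    rw [hK e (hF e he), mul_sum]
    exact sum_congr rfl fun k _ => by ring
  rw [hswap E w hE, hswap E' w' hE', ← sum_sub_distrib, mul_sum]
  refine (abs_sum_le_sum_abs _ _).trans (sum_le_sum fun k _ => ?_)
  rw [← mul_sub, abs_mul, abs_of_nonneg (ha k), mul_left_comm]
  convert mul_le_mul_of_nonneg_left (h (c k)) (ha k)

variable [DecidableEq V]

/-- The total weight of the hyperarcs with `q.1` in the tail and `q.2` in the head. -/
def pairWeight (E : Finset (Finset V × Finset V)) (w : Finset V × Finset V → ℝ) (q : V × V) : ℝ :=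
  ∑ e ∈ E with q ∈ e.1 ×ˢ e.2, w e

/-- An upper bound on the relative contribution of `e` to any crossing sum. -/
noncomputable def sensitivity (E : Finset (Finset V × Finset V)) (w : Finset V × Finset V → ℝ)
    (e : Finset V × Finset V) : ℝ :=
  ∑ q ∈ e.1 ×ˢ e.2, w e / pairWeight E w q

theorem le_pairWeight (E : Finset (Finset V × Finset V)) (w : Finset V × Finset V → ℝ)
    (hw : ∀ e ∈ E, 0 < w e) {e : Finset V × Finset V} (he : e ∈ E) {q : V × V}
    (hq : q ∈ e.1 ×ˢ e.2) : w e ≤ pairWeight E w q :=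
  single_le_sum (f := w) (fun i hi => (hw i (mem_filter.1 hi).1).le) (mem_filter.2 ⟨he, hq⟩)

theorem div_pairWeight_le_sensitivity (E : Finset (Finset V × Finset V))
    (w : Finset V × Finset V → ℝ) (hw : ∀ e ∈ E, 0 < w e) {e : Finset V × Finset V} (he : e ∈ E)
    {q : V × V} (hq : q ∈ e.1 ×ˢ e.2) : w e / pairWeight E w q ≤ sensitivity E w e :=
  single_le_sum (f := fun q => w e / pairWeight E w q)
    (fun _ hi => div_nonneg (hw e he).le ((hw e he).le.trans (le_pairWeight E w hw he hi))) hq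

theorem sensitivity_pos (E : Finset (Finset V × Finset V))
    (w : Finset V × Finset V → ℝ) (hw : ∀ e ∈ E, 0 < w e) {e : Finset V × Finset V} (he : e ∈ E)
    (hne : e.1.Nonempty ∧ e.2.Nonempty) : 0 < sensitivity E w e := by
  obtain ⟨q, hq⟩ := hne.1.product hne.2
  exact (div_pos (hw e he) ((hw e he).trans_le (le_pairWeight E w hw he hq))).trans_le
    (div_pairWeight_le_sensitivity E w hw he hq)

theorem sum_sensitivity_le [Fintype V] (E : Finset (Finset V × Finset V))
    (w : Finset V × Finset V → ℝ) :
    ∑ e ∈ E, sensitivity E w e ≤ (Fintype.card V : ℝ) ^ 2 := by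
  calc ∑ e ∈ E, sensitivity E w e
      = ∑ q : V × V, pairWeight E w q / pairWeight E w q := by
        simp_rw [sensitivity]
        rw [sum_comm' (t' := univ) (s' := fun q => E.filter fun e => q ∈ e.1 ×ˢ e.2)
          (by intro e q; simp)]
        refine sum_congr rfl fun q _ => ?_
        rw [← sum_div]
        rfl
    _ ≤ ∑ _q : V × V, (1 : ℝ) := sum_le_sum fun q _ => div_self_le_one _
    _ = _ := by simp [sq]

open Classical in
theorem weight_le_sensitivity_mul (E : Finset (Finset V × Finset V))
    (w : Finset V × Finset V → ℝ) (hw : ∀ e ∈ E, 0 < w e) {e : Finset V × Finset V} (he : e ∈ E)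
    (hne : e.1.Nonempty ∧ e.2.Nonempty) (c : Finset V × Finset V) :
    w e * (if Crosses c e then 1 else 0) ≤
      sensitivity E w e * ∑ e' ∈ E, w e' * (if Crosses c e' then 1 else 0) := by
  have hsum0 : ∀ e' ∈ E, 0 ≤ w e' * (if Crosses c e' then (1 : ℝ) else 0) := fun e' he' =>
    mul_nonneg (hw e' he').le (by split_ifs <;> simp)
  by_cases hc : Crosses c e
  · obtain ⟨⟨u, hu, huc⟩, v, hv, hvc⟩ := id hc
    have hq : (u, v) ∈ e.1 ×ˢ e.2 := mem_product.2 ⟨hu, hv⟩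
    have hpos : 0 < pairWeight E w (u, v) := (hw e he).trans_le (le_pairWeight E w hw he hq)
    have hle : pairWeight E w (u, v) ≤ ∑ e' ∈ E, w e' * (if Crosses c e' then 1 else 0) := by
      rw [pairWeight, sum_filter]
      refine sum_le_sum fun e' he' => ?_
      split_ifs with h1 h2 h2
      · simp
      · exact absurd ⟨⟨u, (mem_product.1 h1).1, huc⟩, v, (mem_product.1 h1).2, hvc⟩ h2
      · simpa using (hw e' he').le
      · simp
    rw [if_pos hc, mul_one]
    calc w e = w e / pairWeight E w (u, v) * pairWeight E w (u, v) :=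
          (div_mul_cancel₀ _ hpos.ne').symm
      _ ≤ _ := mul_le_mul (div_pairWeight_le_sensitivity E w hw he hq) hle hpos.le
          (sensitivity_pos E w hw he hne).le
  · rw [if_neg hc, mul_zero]
    exact mul_nonneg (sensitivity_pos E w hw he hne).le (sum_nonneg hsum0)

/-- Sampling `M` hyperarcs with probabilities proportional to their sensitivities. -/
theorem exists_subhypergraph_of_card_le [Fintype V] (hV : 0 < Fintype.card V)
    (E : Finset (Finset V × Finset V)) (w : Finset V × Finset V → ℝ) (hw : ∀ e ∈ E, 0 < w e)
    (hE : ∀ e ∈ E, e.1.Nonempty ∧ e.2.Nonempty) {δ : ℝ} (hδ : 0 < δ) (hδ1 : δ ≤ 1)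
    (M : ℕ) (hM0 : 0 < M) (hM : Real.log (2 * 4 ^ Fintype.card V) ≤
      M * (δ ^ 2 / (4 * (Fintype.card V : ℝ) ^ 2))) :
    ∃ (E' : Finset (Finset V × Finset V)) (w' : Finset V × Finset V → ℝ),
      E' ⊆ E ∧ (∀ e ∈ E', 0 ≤ w' e) ∧ E'.card ≤ M ∧ ∀ x : V → ℝ,
        |∑ e ∈ E', w' e * arcEnergy e x - ∑ e ∈ E, w e * arcEnergy e x| ≤
          δ * ∑ e ∈ E, w e * arcEnergy e x := by
  classical
  rcases E.eq_empty_or_nonempty with rfl | hne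
  · exact ⟨∅, 0, by simp, by simp, by simp, by simp⟩
  set Z : ℝ := ∑ e ∈ E, sensitivity E w e with hZ
  have hσ : ∀ e ∈ E, 0 < sensitivity E w e := fun e he => sensitivity_pos E w hw he (hE e he)
  have hZpos : 0 < Z := sum_pos hσ hne
  have hMpos : (0 : ℝ) < M := by exact_mod_cast hM0
  set p : Finset V × Finset V → ℝ := fun e => sensitivity E w e / Z with hp
  have hppos : ∀ e ∈ E, 0 < p e := fun e he => div_pos (hσ e he) hZpos
  set κ : Finset V × Finset V → ℝ := fun c =>
    ∑ e ∈ E, w e * (if Crosses c e then 1 else 0) with hκ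
  have hκ0 : ∀ c, 0 ≤ κ c := fun c => sum_nonneg fun e he =>
    mul_nonneg (hw e he).le (by split_ifs <;> simp)
  obtain ⟨f, hfE, hf⟩ := exists_seq_abs_sum_sub_le E p hppos
    (by rw [hp, ← sum_div, ← hZ, div_self hZpos.ne'])
    (univ : Finset (Finset V × Finset V))
    (fun c e => w e * (if Crosses c e then 1 else 0) / p e) κ
    (R := (Fintype.card V : ℝ) ^ 2) (by positivity) hδ hδ1
    (fun c _ e he => div_nonneg (mul_nonneg (hw e he).le (by split_ifs <;> simp))
      (hppos e he).le)
    (fun c _ e he => by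
      rw [div_le_iff₀ (hppos e he)]
      calc _ ≤ sensitivity E w e * κ c := weight_le_sensitivity_mul E w hw he (hE e he) c
        _ = Z * κ c * p e := by rw [hp]; field_simp
        _ ≤ _ := mul_le_mul_of_nonneg_right
          (mul_le_mul_of_nonneg_right (sum_sensitivity_le E w) (hκ0 c)) (hppos e he).le)
    (fun c _ => sum_congr rfl fun e he => mul_div_cancel₀ _ (hppos e he).ne') M
    (by
      refine le_trans (le_of_eq ?_) hM
      congr 2
      rw [card_univ, Fintype.card_prod, Fintype.card_finset, ← pow_two, ← pow_mul, mul_comm,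
        pow_mul]
      norm_num)
  have hsum : ∀ z : Finset V × Finset V → ℝ,
      ∑ e ∈ (range M).image f, (((range M).filter fun k => f k = e).card * (w e / p e) / M) * z e
        = (∑ k ∈ range M, w (f k) * z (f k) / p (f k)) / M := by
    intro z
    rw [← sum_fiberwise_of_maps_to (g := f) (t := (range M).image f)
      (fun k hk => mem_image_of_mem f hk), sum_div]
    refine sum_congr rfl fun e _ => ?_
    rw [sum_congr rfl (g := fun _ => w e * z e / p e)
      (fun k hk => by rw [(mem_filter.1 hk).2]), sum_const, nsmul_eq_mul]
    ring
  have hsub : (range M).image f ⊆ E := fun e he => by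
    obtain ⟨k, -, rfl⟩ := mem_image.1 he
    exact hfE k
  refine ⟨(range M).image f,
    fun e => ((range M).filter fun k => f k = e).card * (w e / p e) / M, hsub,
    fun e he => ?_, card_image_le.trans (card_range M).le,
    abs_sum_arcEnergy_sub_le _ _ _ _ _ hE (fun e he => hE e (hsub he)) fun c => ?_⟩
  · exact div_nonneg (mul_nonneg (Nat.cast_nonneg _)
      (div_nonneg (hw e (hsub he)).le (hppos e (hsub he)).le)) hMpos.le
  · rw [hsum]
    have hc := hf c (mem_univ c)
    change |_ / (M : ℝ) - κ c| ≤ δ * κ c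
    rw [div_sub' hMpos.ne', abs_div, abs_of_pos hMpos, div_le_iff₀ hMpos]
    calc _ ≤ δ * (M * κ c) := hc
      _ = _ := by ring

end Hypergraph

/-- Every weighted directed hypergraph on `n ≥ 2` vertices admits, for every
`ε ∈ (0,1)`, an ε-spectral sparsifier with `O(n³ log n / ε²)` hyperarcs. -/
theorem directed_hypergraph_spectral_sparsifier :
    ∃ C : ℝ, 0 < C ∧
      ∀ (V : Type) [Fintype V] [DecidableEq V]
        (E : Finset (Finset V × Finset V)) (w : Finset V × Finset V → ℝ),
        (∀ e ∈ E, e.1.Nonempty ∧ e.2.Nonempty) → (∀ e ∈ E, 0 ≤ w e) →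
        2 ≤ Fintype.card V →
        ∀ ε : ℝ, 0 < ε → ε < 1 →
        ∃ (E' : Finset (Finset V × Finset V)) (w' : Finset V × Finset V → ℝ),
          E' ⊆ E ∧ (∀ e ∈ E', 0 ≤ w' e) ∧
          (E'.card : ℝ) ≤
            C * (Fintype.card V : ℝ) ^ 3 * Real.log (Fintype.card V) / ε ^ 2 ∧
          ∀ x : V → ℝ,
            (1 - ε) * dirHyperQuadForm E' w' x ≤ dirHyperQuadForm E w x ∧
            dirHyperQuadForm E w x ≤ (1 + ε) * dirHyperQuadForm E' w' x := by
  refine ⟨100, by norm_num, fun V _ _ E w hE hw hn ε hε hε1 => ?_⟩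
  set n : ℝ := (Fintype.card V : ℝ) with hn_def
  have hn2 : (2 : ℝ) ≤ n := by rw [hn_def]; exact_mod_cast hn
  have hM1 : (1 : ℝ) ≤ n ^ 3 / ε ^ 2 := by
    rw [le_div_iff₀ (by positivity)]
    have h1 : ε ^ 2 ≤ 1 := pow_le_one₀ hε.le hε1.le
    have h2 : (1 : ℝ) ≤ n ^ 3 := one_le_pow₀ (by linarith)
    linarith
  have hMle : 48 * (n ^ 3 / ε ^ 2) ≤ ⌈48 * (n ^ 3 / ε ^ 2)⌉₊ := Nat.le_ceil _
  have hMlt : (⌈48 * (n ^ 3 / ε ^ 2)⌉₊ : ℝ) < 48 * (n ^ 3 / ε ^ 2) + 1 :=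
    Nat.ceil_lt_add_one (by positivity)
  have hlog : Real.log (2 * 4 ^ Fintype.card V) ≤
      ⌈48 * (n ^ 3 / ε ^ 2)⌉₊ * ((ε / 2) ^ 2 / (4 * n ^ 2)) := by
    have h4 : Real.log (2 * 4 ^ Fintype.card V) = (2 * n + 1) * Real.log 2 := by
      rw [Real.log_mul (by norm_num) (by positivity), Real.log_pow,
        show (4 : ℝ) = 2 ^ 2 by norm_num, Real.log_pow, hn_def]
      push_cast
      ring
    have hl2 : Real.log 2 ≤ 1 := by linarith [Real.log_two_lt_d9]
    calc _ = (2 * n + 1) * Real.log 2 := h4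
      _ ≤ (2 * n + 1) * 1 := mul_le_mul_of_nonneg_left hl2 (by linarith)
      _ ≤ 3 * n := by linarith
      _ = 48 * (n ^ 3 / ε ^ 2) * ((ε / 2) ^ 2 / (4 * n ^ 2)) := by field_simp; norm_num
      _ ≤ _ := mul_le_mul_of_nonneg_right hMle (by positivity)
  obtain ⟨E', w', hsub, hw', hcard, hQ⟩ := exists_subhypergraph_of_card_le (by omega)
    (E.filter fun e => 0 < w e) w (fun e he => (mem_filter.1 he).2)
    (fun e he => hE e (mem_filter.1 he).1) (half_pos hε) (by linarith) ⌈48 * (n ^ 3 / ε ^ 2)⌉₊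
    (Nat.ceil_pos.2 (by positivity)) hlog
  refine ⟨E', w', hsub.trans (filter_subset _ _), hw', ?_, fun x => ?_⟩
  · have hl : (1 / 2 : ℝ) ≤ Real.log n := by
      have := Real.log_le_log (by norm_num) hn2
      linarith [Real.log_two_gt_d9]
    calc (E'.card : ℝ) ≤ ⌈48 * (n ^ 3 / ε ^ 2)⌉₊ := by exact_mod_cast hcard
      _ ≤ 100 * (n ^ 3 / ε ^ 2) * (1 / 2) := by linarith
      _ ≤ 100 * (n ^ 3 / ε ^ 2) * Real.log n := mul_le_mul_of_nonneg_left hl (by positivity)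
      _ = _ := by ring
  · have hpos : ∑ e ∈ E with 0 < w e, w e * arcEnergy e x = dirHyperQuadForm E w x := by
      refine sum_subset (filter_subset _ _) fun e he hne => ?_
      have : w e = 0 := le_antisymm (not_lt.1 fun h => hne (mem_filter.2 ⟨he, h⟩)) (hw e he)
      rw [this, zero_mul]
    have hx := hQ x
    rw [hpos, show ∑ e ∈ E', w' e * arcEnergy e x = dirHyperQuadForm E' w' x from rfl,
      abs_le] at hx
    have hG : 0 ≤ dirHyperQuadForm E w x := by nlinarith [hx.1, hx.2]
    obtain ⟨h1, h2⟩ := hx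
    constructor
    · nlinarith [mul_le_mul_of_nonneg_left h2 (sub_nonneg.2 hε1.le),
        mul_nonneg (mul_nonneg hε.le hG) hε.le, mul_nonneg hε.le hG]
    · nlinarith [mul_le_mul_of_nonneg_left h1 (by linarith : 0 ≤ 1 + ε),
        mul_nonneg (mul_nonneg hε.le hG) (sub_nonneg.2 hε1.le)]
end

section
/- Let G = (V, E) be an unweighted undirected hypergraph on a finite vertex set V with n = |V| vertices in which every hyperedge e ∈ E has at least two vertices, and for u ≠ v in V let d_G(u, v) = |{e ∈ E : u ∈ e and v ∈ e}| be the number of hyperedges containing both u and v. Then Σ_{e ∈ E} 1 / (min over pairs u ≠ v with u, v ∈ e of d_G(u, v)) ≤ n(n−1)/2. -/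
open Finset

/-- `codegree E u v` is the number of hyperedges of `E` containing both `u` and `v`. -/
def codegree {V : Type} [DecidableEq V] (E : Finset (Finset V)) (u v : V) : ℕ :=
  (E.filter fun e => u ∈ e ∧ v ∈ e).card

/-- A finite set with at least two elements has a nonempty off-diagonal. -/
theorem offDiag_nonempty_of_two_le_card {α : Type} [DecidableEq α] {s : Finset α}
    (h : 2 ≤ s.card) : s.offDiag.Nonempty := by
  obtain ⟨a, ha, b, hb, hab⟩ := Finset.one_lt_card.mp h
  exact ⟨(a, b), Finset.mem_offDiag.mpr ⟨ha, hb, hab⟩⟩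

theorem codegree_eq_card_filter_subset {V : Type} [DecidableEq V] (E : Finset (Finset V))
    (u v : V) : codegree E u v = (E.filter fun e => {u, v} ⊆ e).card := by
  simp [codegree, insert_subset_iff]

/-- If every edge `e` is assigned a subset `f e` lying in `T`, then the inverse codegrees of the
assigned subsets sum to at most `#T`. -/
theorem sum_inv_card_filter_superset_le {V : Type} [DecidableEq V] (E T : Finset (Finset V))
    (f : E → Finset V) (hfT : ∀ e, f e ∈ T) (hf : ∀ e, f e ⊆ e.1) :
    ∑ e ∈ E.attach, (1 : ℝ) / ((E.filter fun e' => f e ⊆ e').card : ℝ) ≤ T.card := by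
  rw [← sum_fiberwise_of_maps_to (fun e _ => hfT e), card_eq_sum_ones, Nat.cast_sum]
  refine sum_le_sum fun t _ => ?_
  have hcard : (E.attach.filter fun e => f e = t).card ≤ (E.filter fun e => t ⊆ e).card := by
    refine card_le_card_of_injOn Subtype.val (fun e he => ?_) Subtype.val_injective.injOn
    have he' : f e = t := (mem_filter.mp he).2
    exact mem_filter.mpr ⟨e.2, he' ▸ hf e⟩
  calc ∑ e ∈ E.attach.filter (fun e => f e = t),
        (1 : ℝ) / ((E.filter fun e' => f e ⊆ e').card : ℝ)
      = ∑ _e ∈ E.attach.filter (fun e => f e = t),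
        (1 : ℝ) / ((E.filter fun e' => t ⊆ e').card : ℝ) :=
        sum_congr rfl fun e he => by rw [(mem_filter.mp he).2]
    _ = ((E.attach.filter fun e => f e = t).card : ℝ) /
        ((E.filter fun e' => t ⊆ e').card : ℝ) := by
        rw [sum_const, nsmul_eq_mul, mul_one_div]
    _ ≤ ((1 : ℕ) : ℝ) := by
        rw [Nat.cast_one]
        exact div_le_one_of_le₀ (by exact_mod_cast hcard) (Nat.cast_nonneg _)

/-- For an unweighted undirected hypergraph on `n` vertices in which every
hyperedge has at least two vertices,
`Σ_{e ∈ E} 1 / (min_{u ≠ v, u, v ∈ e} d_G(u,v)) ≤ n(n-1)/2`, where `d_G(u,v)` is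
the number of hyperedges containing both `u` and `v`. -/
theorem sum_inv_min_codegree_le {V : Type} [Fintype V] [DecidableEq V]
    (E : Finset (Finset V)) (h2 : ∀ e ∈ E, 2 ≤ e.card) :
    ∑ e ∈ E.attach,
        (1 : ℝ) /
          (e.1.offDiag.inf' (offDiag_nonempty_of_two_le_card (h2 e.1 e.2))
            fun p => (codegree E p.1 p.2 : ℝ)) ≤
      (Fintype.card V : ℝ) * ((Fintype.card V : ℝ) - 1) / 2 := by
  choose p hp hmin using fun e : E =>
    exists_mem_eq_inf' (offDiag_nonempty_of_two_le_card (h2 e.1 e.2))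
      fun p => (codegree E p.1 p.2 : ℝ)
  simp_rw [hmin, codegree_eq_card_filter_subset]
  have h := sum_inv_card_filter_superset_le E (powersetCard 2 univ)
    (fun e => {(p e).1, (p e).2})
    (fun e => mem_powersetCard.mpr ⟨subset_univ _, card_pair (mem_offDiag.mp (hp e)).2.2⟩)
    (fun e => insert_subset (mem_offDiag.mp (hp e)).1
      (singleton_subset_iff.mpr (mem_offDiag.mp (hp e)).2.1))
  rwa [card_powersetCard, card_univ, Nat.cast_choose_two] at h
end
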